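/- Chang's Conjecture implies that there is no strong ω₂-chain of functions from ω₁ to ω₁: if for every function F from finite tuples of ordinals below ω₂ to ordinals below ω₂ there exists a set X of ordinals below ω₂ closed under F with |X| = ℵ₁ and |X ∩ ω₁| ≤ ℵ₀, then there is no sequence ⟨f_α : α < ω₂⟩ of functions f_α : ω₁ → ω₁ such that for all α < β < ω₂ the set {ξ < ω₁ : f_α(ξ) ≥ f_β(ξ)} is finite. -/

import Mathlib

open Cardinal Ordinal

/-- The type of countable ordinals, i.e. ordinals below `ω₁`. -/
abbrev Omega1 := {ξ : Ordinal.{0} // ξ < (Cardinal.aleph 1).ord}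

/-- The type of ordinals below `ω₂`. -/
abbrev Omega2 := {ξ : Ordinal.{0} // ξ < (Cardinal.aleph 2).ord}

/-- Chang's Conjecture: for every function `F` from finite tuples of ordinals below `ω₂`
to ordinals below `ω₂` there is a set `X ⊆ ω₂` closed under `F` with `|X| = ℵ₁` and
`|X ∩ ω₁| ≤ ℵ₀`. -/
def ChangsConjecture : Prop :=
  ∀ F : List Omega2 → Omega2,
    ∃ X : Set Omega2,
      (∀ l : List Omega2, (∀ x ∈ l, x ∈ X) → F l ∈ X) ∧
      Cardinal.mk ↥X = Cardinal.aleph 1 ∧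
      Cardinal.mk ↥{x : Omega2 | x ∈ X ∧ x.val < (Cardinal.aleph 1).ord} ≤ Cardinal.aleph0

theorem mk_omega1 : #Omega1 = ℵ₁ := by
  refine (Cardinal.mk_Iio_ordinal (Cardinal.aleph 1).ord).trans ?_
  rw [Cardinal.card_ord, Cardinal.lift_aleph, Ordinal.lift_one]

instance uncountable_omega1 : Uncountable Omega1 := by
  rw [← Cardinal.aleph0_lt_mk_iff, mk_omega1]
  exact Cardinal.aleph0_lt_aleph_one

theorem countable_Iic_omega1 (ξ : Omega1) : (Set.Iic ξ).Countable := by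
  have h : (Set.Iio (ξ.1 + 1)).Countable := by
    rw [← Cardinal.le_aleph0_iff_set_countable, Cardinal.mk_Iio_ordinal,
      ← Cardinal.lift_aleph0.{1, 0}, Cardinal.lift_le, ← Cardinal.lt_aleph_one_iff,
      ← Cardinal.lt_ord]
    exact (Cardinal.isSuccLimit_ord (Cardinal.aleph0_le_aleph 1)).add_one_lt ξ.2
  refine (h.preimage Subtype.val_injective).mono fun η hη => ?_
  exact Order.lt_add_one_iff.2 (show η.1 ≤ ξ.1 from hη)

/-- A set of size `ℵ₁` is strictly bounded in `ω₂`. -/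
theorem exists_forall_mem_lt_omega2 {X : Set Omega2} (hX : #X = ℵ₁) :
    ∃ β : Omega2, ∀ x ∈ X, x < β := by
  have hsmall : ∀ x : X, x.1.1 + 1 < (Cardinal.aleph 2).ord := fun x =>
    (Cardinal.isSuccLimit_ord (Cardinal.aleph0_le_aleph 2)).add_one_lt x.1.2
  have hreg : (Cardinal.aleph.{0} 2).IsRegular := by
    simpa [one_add_one_eq_two] using Cardinal.isRegular_aleph_add_one 1
  refine ⟨⟨⨆ x : X, (x.1.1 + 1), ?_⟩, fun x hx => ?_⟩
  · refine Ordinal.lift_iSup_lt_of_lt_cof ?_ hsmall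
    rw [hX, ← Ordinal.lift_cof, hreg.cof_ord]
    simp
  · have hb : BddAbove (Set.range fun x : X => x.1.1 + 1) :=
      ⟨_, Set.forall_mem_range.2 fun x => (hsmall x).le⟩
    exact (lt_add_one x.1).trans_le (le_ciSup hb ⟨x, hx⟩)

/-- Chang's Conjecture gives a set `X` of size `ℵ₁` for which the countable subsets `e α β` of `ω₁`,
with `α` and `β` in `X`, are all contained in a single countable set. -/
theorem ChangsConjecture.exists_closed (CC : ChangsConjecture)
    (e : Omega2 → Omega2 → Set Omega1) (he : ∀ α β, (e α β).Countable) :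
    ∃ (X : Set Omega2) (S : Set Omega1), #X = ℵ₁ ∧ S.Countable ∧
      ∀ α ∈ X, ∀ β ∈ X, e α β ⊆ S := by
  have hle : (Cardinal.aleph.{0} 1).ord ≤ (Cardinal.aleph 2).ord := by
    simp
  let ι : Omega1 → Omega2 := fun ξ => ⟨ξ.1, ξ.2.trans_le hle⟩
  have hι : Function.Injective ι := fun a b h =>
    Subtype.ext (congrArg (fun x : Omega2 => x.1) h)
  have hg : ∀ α β, ∃ g : ℕ → Omega1, e α β ⊆ Set.range g := fun α β =>
    Set.countable_iff_exists_subset_range.1 (he α β)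
  choose g hg using hg
  obtain ⟨X, hF, hX, hX'⟩ := CC fun l => match l with
    | α :: β :: l => ι (g α β l.length)
    | _ => ι ⟨0, Cardinal.isRegular_aleph_one.ord_pos⟩
  refine ⟨X, ι ⁻¹' {x | x ∈ X ∧ x.val < (Cardinal.aleph 1).ord}, hX,
    (Cardinal.le_aleph0_iff_set_countable.1 hX').preimage hι, fun α hα β hβ ξ hξ => ?_⟩
  obtain ⟨n, rfl⟩ := hg α β hξ
  refine ⟨?_, (g α β n).2⟩
  have := hF (α :: β :: List.replicate n α) (by
    intro x hx
    simp only [List.mem_cons, List.mem_replicate] at hx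
    rcases hx with rfl | rfl | ⟨-, rfl⟩ <;> assumption)
  simpa using this

/-- The statement for families indexed by the type `Omega2`. -/
theorem ChangsConjecture.not_strong_chain (CC : ChangsConjecture)
    (f : Omega2 → Omega1 → Omega1) :
    ¬ ∀ α β, α < β → {ξ | f β ξ ≤ f α ξ}.Finite := by
  intro hf
  obtain ⟨X, S, hX, hS, hXS⟩ := CC.exists_closed
    (fun α β => {ξ | α < β ∧ f β ξ ≤ f α ξ}) fun α β => by
      by_cases h : α < β
      · simpa [h] using (hf α β h).countable
      · simp [h]
  have hmono : ∀ ξ ∉ S, StrictMonoOn (f · ξ) X := fun ξ hξ α hα β hβ hαβ =>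
    lt_of_not_ge fun h => hξ (hXS α hα β hβ ⟨hαβ, h⟩)
  obtain ⟨β, hβ⟩ := exists_forall_mem_lt_omega2 hX
  have hinf : Sᶜ.Infinite := fun h =>
    Set.not_countable_univ (Set.union_compl_self S ▸ hS.union h.countable)
  let ξ : ℕ ↪ ↥Sᶜ := hinf.natEmbedding
  have hcount : (⋃ n, {α ∈ X | f α (ξ n) ≤ f β (ξ n)}).Countable := by
    refine Set.countable_iUnion fun n => ?_
    refine Set.MapsTo.countable_of_injOn (f := (f · (ξ n).1)) (t := Set.Iic (f β (ξ n)))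
      (fun α hα => hα.2) ?_ (countable_Iic_omega1 _)
    exact (hmono _ (ξ n).2).injOn.mono fun α hα => hα.1
  obtain ⟨α, hα, hα'⟩ : ∃ α ∈ X, α ∉ ⋃ n, {α ∈ X | f α (ξ n) ≤ f β (ξ n)} := by
    by_contra! h
    exact (hX ▸ Cardinal.le_aleph0_iff_set_countable.2 (hcount.mono h)).not_gt
      Cardinal.aleph0_lt_aleph_one
  refine Set.infinite_of_injective_forall_mem (f := fun n => (ξ n).1)
    (Subtype.val_injective.comp ξ.injective) (fun n => ?_) (hf α β (hβ α hα))
  exact le_of_not_ge fun h => hα' (Set.mem_iUnion.2 ⟨n, hα, h⟩)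

/-- Chang's Conjecture implies that there is no strong `ω₂`-chain of functions from
`ω₁` to `ω₁`. -/
theorem no_strong_omega2_chain_of_functions_of_changsConjecture
    (CC : ChangsConjecture) :
    ¬ ∃ f : Ordinal → (Omega1 → Omega1),
        ∀ α β : Ordinal, α < β → β < (Cardinal.aleph 2).ord →
          {ξ : Omega1 | f β ξ ≤ f α ξ}.Finite := by
  rintro ⟨f, hf⟩
  refine CC.not_strong_chain (fun α => f (Ordinal.lift α.1)) fun α β hαβ => ?_
  refine hf _ _ (Ordinal.lift_lt.2 hαβ) ?_
  simpa using β.2
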